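/- Local functional equation of Jacquet–Langlands type: let ℓ ∈ ℤ and ν, s ∈ ℂ with 0 < Re ν < 1/2 and Re ν < Re s < 1 − Re ν. Define Γ_ℓ(s,ν) := ∫₀^{∞} y^{s−ν−1} · ( ∫_{−∞}^{∞} e^{−2πiyξ} (ξ²+1)^{−ν−1/2} ((ξ−i)/(ξ+i))^{ℓ} dξ ) dy (the inner integral converges absolutely and the outer integral converges absolutely). Then (−1)^ℓ · Γ_ℓ(s,ν) = 2·(2π)^{−2s}·Γ(s+ν)·Γ(s−ν)·( cos(πs)·Γ_ℓ(1−s,ν) + cos(πν)·Γ_{−ℓ}(1−s,ν) ). -/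

import Mathlib

open MeasureTheory

/-- The Mellin transform Γ_ℓ(s,ν) = ∫₀^∞ y^{s−ν−1} (∫ e^{−2πiyξ} (ξ²+1)^{−ν−1/2}
((ξ−i)/(ξ+i))^ℓ dξ) dy of the Jacquet transform of the weight-2ℓ weight function. -/
noncomputable def GammaEll (ℓ : ℤ) (s ν : ℂ) : ℂ :=
  ∫ y in Set.Ioi (0 : ℝ),
    (y : ℂ) ^ (s - ν - 1) *
      ∫ ξ : ℝ,
        Complex.exp (-2 * (Real.pi : ℂ) * Complex.I * (y : ℂ) * (ξ : ℂ)) *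
          ((ξ ^ 2 + 1 : ℝ) : ℂ) ^ (-ν - 1 / 2) *
          (((ξ : ℂ) - Complex.I) / ((ξ : ℂ) + Complex.I)) ^ ℓ

open Filter Topology Set FourierTransform

lemma integrableOn_rpow_mul_exp_neg_mul_Ioi {σ : ℝ} (hσ : 0 < σ) {ε : ℝ} (hε : 0 < ε) :
    IntegrableOn (fun y : ℝ => y ^ (σ - 1) * Real.exp (-(ε * y))) (Ioi 0) := by
  have h2 := (integrableOn_Ioi_comp_mul_left_iff
    (fun x : ℝ => Real.exp (-x) * x ^ (σ - 1)) 0 hε).2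
    (by simpa using Real.GammaIntegral_convergent hσ)
  refine IntegrableOn.congr_fun (h2.const_mul (ε ^ (σ - 1))⁻¹) (fun y hy => ?_) measurableSet_Ioi
  have : (ε ^ (σ - 1)) ≠ 0 := (Real.rpow_pos_of_pos hε _).ne'
  simp only [Real.mul_rpow hε.le (mem_Ioi.1 hy).le]
  field_simp

lemma integrableOn_cpow_mul_exp_neg_mul_Ioi {a : ℂ} (ha : 0 < a.re) {r : ℂ} (hr : 0 < r.re) :
    IntegrableOn (fun y : ℝ => (y : ℂ) ^ (a - 1) * Complex.exp (-(r * y))) (Ioi 0) := by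
  refine (integrableOn_rpow_mul_exp_neg_mul_Ioi ha hr).mono' ?_ ?_
  · exact Measurable.aestronglyMeasurable (by fun_prop)
  · filter_upwards [ae_restrict_mem measurableSet_Ioi] with y hy
    rw [norm_mul, Complex.norm_cpow_eq_rpow_re_of_pos hy, Complex.norm_exp]
    simp

/-- Euler's integral for the Gamma function with a complex scaling parameter. -/
lemma integral_cpow_mul_exp_neg_complex_mul_Ioi {a : ℂ} (ha : 0 < a.re) {r : ℂ} (hr : 0 < r.re) :
    ∫ t in Ioi (0 : ℝ), (t : ℂ) ^ (a - 1) * Complex.exp (-(r * t)) =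
      (1 / r) ^ a * Complex.Gamma a := by
  have hopen : IsOpen {z : ℂ | 0 < z.re} := isOpen_lt continuous_const Complex.continuous_re
  have hl : DifferentiableOn ℂ
      (fun r : ℂ => ∫ t in Ioi (0 : ℝ), (t : ℂ) ^ (a - 1) * Complex.exp (-(r * t)))
      {z : ℂ | 0 < z.re} := by
    intro z hz
    have hz : 0 < z.re := hz
    refine DifferentiableAt.differentiableWithinAt (HasDerivAt.differentiableAt
      (hasDerivAt_integral_of_dominated_loc_of_deriv_le
        (μ := volume.restrict (Ioi (0 : ℝ)))
        (F := fun (w : ℂ) (t : ℝ) => (t : ℂ) ^ (a - 1) * Complex.exp (-(w * t)))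
        (F' := fun (w : ℂ) (t : ℝ) => (t : ℂ) ^ (a - 1) * (Complex.exp (-(w * t)) * -t))
        (bound := fun t : ℝ => t ^ (a.re + 1 - 1) * Real.exp (-((z.re / 2) * t)))
        (s := {w : ℂ | z.re / 2 < w.re})
        ((isOpen_lt continuous_const Complex.continuous_re).mem_nhds (by simpa using hz))
        ?_ (integrableOn_cpow_mul_exp_neg_mul_Ioi ha hz) ?_ ?_
        (integrableOn_rpow_mul_exp_neg_mul_Ioi (by linarith) (by linarith)) ?_).2)
    · exact Eventually.of_forall fun w => Measurable.aestronglyMeasurable (by fun_prop)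
    · exact Measurable.aestronglyMeasurable (by fun_prop)
    · filter_upwards [ae_restrict_mem measurableSet_Ioi] with t ht w hw
      have ht : 0 < t := ht
      have hw : z.re / 2 < w.re := hw
      rw [norm_mul, norm_mul, Complex.norm_cpow_eq_rpow_re_of_pos ht, Complex.norm_exp,
        add_sub_right_comm, Real.rpow_add_one ht.ne']
      have : Real.exp (-(w * t)).re ≤ Real.exp (-((z.re / 2) * t)) := by
        gcongr
        simp only [Complex.neg_re, Complex.mul_re, Complex.ofReal_re, Complex.ofReal_im, mul_zero,
          sub_zero]
        gcongr
      calc _ = t ^ (a.re - 1) * t * Real.exp (-(w * t)).re := by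
            simp [abs_of_pos ht]; ring
        _ ≤ _ := by gcongr
    · refine Eventually.of_forall fun t w _ => HasDerivAt.const_mul _ (HasDerivAt.cexp ?_)
      simpa using ((hasDerivAt_id w).mul_const (t : ℂ)).fun_neg
  have hR : DifferentiableOn ℂ (fun r : ℂ => (1 / r) ^ a * Complex.Gamma a)
      {z : ℂ | 0 < z.re} := by
    intro z hz
    have hz : 0 < z.re := hz
    have hz0 : z ≠ 0 := by rintro rfl; simp at hz
    refine DifferentiableAt.differentiableWithinAt (DifferentiableAt.mul_const
      (DifferentiableAt.cpow_const ?_ ?_) _)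
    · exact (differentiableAt_const _).div differentiableAt_id hz0
    · left
      simp only [one_div, Complex.inv_re]
      exact div_pos hz (Complex.normSq_pos.2 hz0)
  refine AnalyticOnNhd.eqOn_of_preconnected_of_frequently_eq (hl.analyticOnNhd hopen)
    (hR.analyticOnNhd hopen) (convex_halfSpace_re_gt 0).isPreconnected
    (z₀ := 1) (by simp) ?_ hr
  have htend : Tendsto (fun x : ℝ => (x : ℂ)) (𝓝[>] 1) (𝓝[≠] 1) := by
    refine tendsto_nhdsWithin_iff.2 ⟨tendsto_nhdsWithin_of_tendsto_nhds ?_, ?_⟩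
    · simpa using (Complex.continuous_ofReal.tendsto 1)
    · filter_upwards [self_mem_nhdsWithin] with x hx
      have : (1 : ℝ) < x := hx
      simpa using this.ne'
  refine htend.frequently (Eventually.frequently ?_)
  filter_upwards [self_mem_nhdsWithin] with x hx
  exact Complex.integral_cpow_mul_exp_neg_mul_Ioi ha (zero_lt_one.trans hx)

/-- The regularized Mellin transform of a Fourier transform, computed by Fubini. -/
lemma integral_cpow_mul_exp_mul_fourier {f : ℝ → ℂ} (hf : Integrable f) {a : ℂ} (ha : 0 < a.re)
    {ε : ℝ} (hε : 0 < ε) :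
    ∫ y in Ioi (0 : ℝ), ((y : ℂ) ^ (a - 1) * Complex.exp (-(ε * y))) * 𝓕 f y =
      ∫ ξ : ℝ, (1 / (ε + 2 * Real.pi * Complex.I * ξ)) ^ a * Complex.Gamma a * f ξ := by
  have hg := integrableOn_cpow_mul_exp_neg_mul_Ioi ha (r := (ε : ℂ)) (by simpa using hε)
  have key : ∀ y ξ : ℝ, ‖Complex.exp (↑(-2 * Real.pi * ξ * y) * Complex.I)‖ = 1 := fun y ξ =>
    Complex.norm_exp_ofReal_mul_I _
  have hprod : Integrable (Function.uncurry fun (y ξ : ℝ) =>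
      ((y : ℂ) ^ (a - 1) * Complex.exp (-(ε * y))) *
        (Complex.exp (↑(-2 * Real.pi * ξ * y) * Complex.I) * f ξ))
      ((volume.restrict (Ioi (0 : ℝ))).prod volume) := by
    have h := (Integrable.mul_prod hg hf).bdd_mul (c := 1)
      (f := fun p : ℝ × ℝ => Complex.exp (↑(-2 * Real.pi * p.2 * p.1) * Complex.I))
      (by fun_prop) (by simp only [key]; simp)
    refine h.congr (Eventually.of_forall fun p => ?_)
    simp only [Function.uncurry]
    ring
  simp_rw [Real.fourier_real_eq_integral_exp_smul, smul_eq_mul, ← integral_const_mul]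
  rw [integral_integral_swap hprod]
  congr 1
  ext ξ
  rw [← integral_cpow_mul_exp_neg_complex_mul_Ioi ha (r := ε + 2 * Real.pi * Complex.I * ξ)
    (by simpa using hε), ← integral_mul_const]
  congr 1
  ext y
  have : Complex.exp (-((ε + 2 * Real.pi * Complex.I * ξ) * y)) =
      Complex.exp (-(ε * y)) * Complex.exp (↑(-2 * Real.pi * ξ * y) * Complex.I) := by
    rw [← Complex.exp_add]; congr 1; push_cast; ring
  rw [this]
  ring

/-- The Mellin transform of a Fourier transform, as an absolutely convergent integral. -/
lemma mellin_fourier {f : ℝ → ℂ} (hf : Integrable f) {a : ℂ} (ha : 0 < a.re)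
    (hF : MellinConvergent (𝓕 f) a) (hM : Integrable fun ξ : ℝ => |ξ| ^ (-a.re) * ‖f ξ‖) :
    mellin (𝓕 f) a =
      ∫ ξ : ℝ, (1 / (2 * Real.pi * Complex.I * ξ)) ^ a * Complex.Gamma a * f ξ := by
  have hl : Tendsto (fun ε : ℝ => ∫ y in Ioi (0 : ℝ),
      ((y : ℂ) ^ (a - 1) * Complex.exp (-(ε * y))) * 𝓕 f y) (𝓝[>] 0) (𝓝 (mellin (𝓕 f) a)) := by
    have hmeas : AEStronglyMeasurable (fun y : ℝ => (y : ℂ) ^ (a - 1) • 𝓕 f y)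
      (volume.restrict (Ioi 0)) := hF.aestronglyMeasurable
    refine tendsto_integral_filter_of_dominated_convergence
      (fun y : ℝ => ‖(y : ℂ) ^ (a - 1) • 𝓕 f y‖) ?_ ?_ hF.norm ?_
    · refine Eventually.of_forall fun ε => ?_
      have : AEStronglyMeasurable (fun y : ℝ => Complex.exp (-(ε * y)))
        (volume.restrict (Ioi 0)) := by fun_prop
      refine (this.mul hmeas).congr (Eventually.of_forall fun y => ?_)
      simp only [Pi.mul_apply, smul_eq_mul]
      ring
    · filter_upwards [self_mem_nhdsWithin] with ε hε
      filter_upwards [ae_restrict_mem measurableSet_Ioi] with y hy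
      have h1 : ‖Complex.exp (-(ε * y))‖ ≤ 1 := by
        rw [Complex.norm_exp]
        have : 0 < ε * y := mul_pos hε hy
        simpa using this.le
      rw [smul_eq_mul, norm_mul, norm_mul, norm_mul]
      calc _ ≤ ‖(y : ℂ) ^ (a - 1)‖ * 1 * ‖𝓕 f y‖ := by gcongr
        _ = _ := by ring
    · refine Eventually.of_forall fun y => ?_
      refine tendsto_nhdsWithin_of_tendsto_nhds ?_
      have : Continuous fun ε : ℝ => (y : ℂ) ^ (a - 1) * Complex.exp (-(ε * y)) * 𝓕 f y := by
        fun_prop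
      simpa using this.tendsto 0
  have hr : Tendsto (fun ε : ℝ => ∫ ξ : ℝ,
      (1 / (ε + 2 * Real.pi * Complex.I * ξ)) ^ a * Complex.Gamma a * f ξ) (𝓝[>] 0)
      (𝓝 (∫ ξ : ℝ, (1 / (2 * Real.pi * Complex.I * ξ)) ^ a * Complex.Gamma a * f ξ)) := by
    refine tendsto_integral_filter_of_dominated_convergence
      (fun ξ : ℝ => ((2 * Real.pi) ^ (-a.re) * Real.exp (Real.pi * |a.im|) * ‖Complex.Gamma a‖) *
        (|ξ| ^ (-a.re) * ‖f ξ‖)) ?_ ?_ (hM.const_mul _) ?_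
    · refine Eventually.of_forall fun ε => ?_
      refine AEStronglyMeasurable.mul ?_ hf.aestronglyMeasurable
      exact Measurable.aestronglyMeasurable (by fun_prop)
    · filter_upwards [self_mem_nhdsWithin] with ε hε
      filter_upwards [compl_mem_ae_iff.2 (measure_singleton (0 : ℝ))] with ξ hξ
      have hξ : 0 < |ξ| := abs_pos.2 hξ
      have hpi := Real.pi_pos
      have hb : ‖(1 / (ε + 2 * Real.pi * Complex.I * ξ) : ℂ)‖ ≤ (2 * Real.pi * |ξ|)⁻¹ := by
        rw [one_div, norm_inv]
        refine inv_anti₀ (by positivity) ?_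
        have := Complex.abs_im_le_norm (ε + 2 * Real.pi * Complex.I * ξ)
        simpa [abs_mul, abs_of_pos hpi] using this
      set z : ℂ := 1 / (ε + 2 * Real.pi * Complex.I * ξ)
      have hc : ‖z ^ a‖ ≤ (2 * Real.pi) ^ (-a.re) * |ξ| ^ (-a.re) *
          Real.exp (Real.pi * |a.im|) := by
        refine (Complex.norm_cpow_le z a).trans ?_
        rw [div_eq_mul_inv, ← Real.exp_neg, ← Real.mul_rpow (by positivity) hξ.le,
          Real.rpow_neg (by positivity), ← Real.inv_rpow (by positivity)]
        gcongr
        refine (neg_le_abs _).trans ?_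
        rw [abs_mul]
        gcongr
        exact Complex.abs_arg_le_pi z
      rw [norm_mul, norm_mul]
      calc _ ≤ ((2 * Real.pi) ^ (-a.re) * |ξ| ^ (-a.re) *
          Real.exp (Real.pi * |a.im|)) * ‖Complex.Gamma a‖ * ‖f ξ‖ := by gcongr
        _ = _ := by ring
    · filter_upwards [compl_mem_ae_iff.2 (measure_singleton (0 : ℝ))] with ξ hξ
      have hξ : ξ ≠ 0 := hξ
      refine tendsto_nhdsWithin_of_tendsto_nhds ?_
      have hne : (2 * Real.pi * Complex.I * ξ : ℂ) ≠ 0 := by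
        simp [Real.pi_ne_zero, hξ]
      have hcont : ContinuousAt (fun ε : ℝ =>
          (1 / (ε + 2 * Real.pi * Complex.I * ξ)) ^ a * Complex.Gamma a * f ξ) 0 := by
        refine (ContinuousAt.mul (ContinuousAt.cpow (ContinuousAt.div (by fun_prop) (by fun_prop)
          (by simpa using hne)) (by fun_prop) ?_) (by fun_prop)).mul (by fun_prop)
        rw [Complex.mem_slitPlane_iff]
        right
        simp [Real.pi_ne_zero, hξ, Complex.normSq_apply]
      simpa [ContinuousAt] using hcont
  refine tendsto_nhds_unique hl (hr.congr' ?_)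
  filter_upwards [self_mem_nhdsWithin] with ε hε
  exact (integral_cpow_mul_exp_mul_fourier hf ha hε).symm

lemma one_div_two_pi_I_mul_cpow {ξ : ℝ} (hξ : 0 < ξ) (a : ℂ) :
    (1 / (2 * Real.pi * Complex.I * ξ)) ^ a =
      ((2 * Real.pi : ℝ) : ℂ) ^ (-a) * Complex.exp (-(Real.pi * Complex.I * a / 2)) *
        (ξ : ℂ) ^ (-a) := by
  have h2 : (0 : ℝ) < 2 * Real.pi := by positivity
  have h : (1 / (2 * Real.pi * Complex.I * ξ) : ℂ) =
      (((2 * Real.pi * ξ)⁻¹ : ℝ) : ℂ) * (-Complex.I) := by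
    have := Real.pi_ne_zero
    push_cast
    field_simp
    simp [neg_div]
  rw [h, Complex.cpow_def_of_ne_zero (by simp [Real.pi_ne_zero, hξ.ne']),
    Complex.cpow_def_of_ne_zero (by exact_mod_cast h2.ne'),
    Complex.cpow_def_of_ne_zero (by exact_mod_cast hξ.ne'),
    Complex.log_ofReal_mul (by positivity) (by simp), Complex.log_neg_I, Real.log_inv,
    Real.log_mul h2.ne' hξ.ne', ← Complex.exp_add, ← Complex.exp_add,
    ← Complex.ofReal_log h2.le, ← Complex.ofReal_log hξ.le]
  congr 1
  push_cast
  ring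

lemma one_div_two_pi_I_mul_neg_cpow {ξ : ℝ} (hξ : 0 < ξ) (a : ℂ) :
    (1 / (2 * Real.pi * Complex.I * ((-ξ : ℝ) : ℂ))) ^ a =
      ((2 * Real.pi : ℝ) : ℂ) ^ (-a) * Complex.exp (Real.pi * Complex.I * a / 2) *
        (ξ : ℂ) ^ (-a) := by
  have h2 : (0 : ℝ) < 2 * Real.pi := by positivity
  have h : (1 / (2 * Real.pi * Complex.I * ((-ξ : ℝ) : ℂ)) : ℂ) =
      (((2 * Real.pi * ξ)⁻¹ : ℝ) : ℂ) * Complex.I := by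
    have := Real.pi_ne_zero
    push_cast
    field_simp
    simp [neg_div]
  rw [h, Complex.cpow_def_of_ne_zero (by simp [Real.pi_ne_zero, hξ.ne']),
    Complex.cpow_def_of_ne_zero (by exact_mod_cast h2.ne'),
    Complex.cpow_def_of_ne_zero (by exact_mod_cast hξ.ne'),
    Complex.log_ofReal_mul (by positivity) (by simp), Complex.log_I, Real.log_inv,
    Real.log_mul h2.ne' hξ.ne', ← Complex.exp_add, ← Complex.exp_add,
    ← Complex.ofReal_log h2.le, ← Complex.ofReal_log hξ.le]
  congr 1
  push_cast
  ring

/-- The Mellin transform of a Fourier transform in terms of the Mellin transforms of the function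
on the two half-lines. -/
lemma mellin_fourier_eq {f : ℝ → ℂ} (hf : Integrable f) {a : ℂ} (ha : 0 < a.re)
    (hF : MellinConvergent (𝓕 f) a) (hM : MellinConvergent f (1 - a))
    (hM' : MellinConvergent (fun ξ => f (-ξ)) (1 - a)) :
    mellin (𝓕 f) a = ((2 * Real.pi : ℝ) : ℂ) ^ (-a) * Complex.Gamma a *
      (Complex.exp (-(Real.pi * Complex.I * a / 2)) * mellin f (1 - a) +
        Complex.exp (Real.pi * Complex.I * a / 2) * mellin (fun ξ => f (-ξ)) (1 - a)) := by
  have hsub : (1 : ℂ) - a - 1 = -a := by ring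
  have hsub' : (1 - a).re - 1 = -a.re := by simp
  have hM1 := (mellin_convergent_iff_norm (s := 1 - a) Subset.rfl measurableSet_Ioi
    hf.aestronglyMeasurable.restrict).1 hM
  have hM2 := (mellin_convergent_iff_norm (s := 1 - a) Subset.rfl measurableSet_Ioi
    hf.comp_neg.aestronglyMeasurable.restrict).1 hM'
  rw [hsub'] at hM1 hM2
  have habs : Integrable fun ξ : ℝ => |ξ| ^ (-a.re) * ‖f ξ‖ := by
    rw [← integrableOn_univ, ← Iic_union_Ioi (a := (0 : ℝ)), integrableOn_union,
      integrableOn_Iic_iff_integrableOn_Iio]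
    constructor
    · have : IntegrableOn (fun ξ : ℝ => |-ξ| ^ (-a.re) * ‖f (- -ξ)‖) (Iio (0 : ℝ)) := by
        refine IntegrableOn.comp_neg_Iio (c := 0) (f := fun ξ : ℝ => |ξ| ^ (-a.re) * ‖f (-ξ)‖) ?_
        rw [neg_zero]
        refine hM2.congr_fun (fun ξ hξ => ?_) measurableSet_Ioi
        simp only [abs_of_pos (mem_Ioi.1 hξ)]
      simpa using this
    · refine hM1.congr_fun (fun ξ hξ => ?_) measurableSet_Ioi
      simp only [abs_of_pos (mem_Ioi.1 hξ)]
  rw [mellin_fourier hf ha hF habs]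
  set g : ℝ → ℂ := fun ξ => (1 / (2 * Real.pi * Complex.I * ξ)) ^ a * Complex.Gamma a * f ξ
  have hg1 : EqOn g (fun ξ => (((2 * Real.pi : ℝ) : ℂ) ^ (-a) * Complex.Gamma a *
      Complex.exp (-(Real.pi * Complex.I * a / 2))) * ((ξ : ℂ) ^ (1 - a - 1) • f ξ)) (Ioi 0) := by
    intro ξ hξ
    simp only [g]
    rw [one_div_two_pi_I_mul_cpow hξ, hsub, smul_eq_mul]
    ring
  have hg2 : EqOn (fun ξ => g (-ξ)) (fun ξ => (((2 * Real.pi : ℝ) : ℂ) ^ (-a) *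
      Complex.Gamma a * Complex.exp (Real.pi * Complex.I * a / 2)) *
        ((ξ : ℂ) ^ (1 - a - 1) • f (-ξ))) (Ioi 0) := by
    intro ξ hξ
    simp only [g]
    rw [one_div_two_pi_I_mul_neg_cpow hξ, hsub, smul_eq_mul]
    ring
  have hi1 : IntegrableOn g (Ioi 0) :=
    IntegrableOn.congr_fun (hM.const_mul _) hg1.symm measurableSet_Ioi
  have hi2 : IntegrableOn (fun ξ => g (-ξ)) (Ioi 0) :=
    IntegrableOn.congr_fun (hM'.const_mul _) hg2.symm measurableSet_Ioi
  have hi3 : IntegrableOn g (Iic 0) := by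
    rw [integrableOn_Iic_iff_integrableOn_Iio]
    have := IntegrableOn.comp_neg_Iio (c := 0) (f := fun ξ => g (-ξ)) (by simpa using hi2)
    simpa using this
  rw [← intervalIntegral.integral_Iic_add_Ioi hi3 hi1, ← neg_zero, ← integral_comp_neg_Ioi,
    neg_zero, setIntegral_congr_fun measurableSet_Ioi hg1,
    setIntegral_congr_fun measurableSet_Ioi hg2, integral_const_mul, integral_const_mul]
  simp only [mellin]
  ring

/-- The function `(ξ² + 1)^(-ν - 1/2) ((ξ - i) / (ξ + i))^ℓ` on the real line. -/
noncomputable def weightFun (ℓ : ℤ) (ν : ℂ) (ξ : ℝ) : ℂ :=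
  ((ξ ^ 2 + 1 : ℝ) : ℂ) ^ (-ν - 1 / 2) * (((ξ : ℂ) - Complex.I) / ((ξ : ℂ) + Complex.I)) ^ ℓ

lemma ofReal_add_I_ne_zero (ξ : ℝ) : (ξ : ℂ) + Complex.I ≠ 0 := fun h => by
  simpa using congrArg Complex.im h

lemma ofReal_sub_I_ne_zero (ξ : ℝ) : (ξ : ℂ) - Complex.I ≠ 0 := fun h => by
  simpa using congrArg Complex.im h

lemma ofReal_sub_I_div_add_I_ne_zero (ξ : ℝ) :
    ((ξ : ℂ) - Complex.I) / ((ξ : ℂ) + Complex.I) ≠ 0 :=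
  div_ne_zero (ofReal_sub_I_ne_zero ξ) (ofReal_add_I_ne_zero ξ)

lemma norm_weightFun (ℓ : ℤ) (ν : ℂ) (ξ : ℝ) :
    ‖weightFun ℓ ν ξ‖ = (ξ ^ 2 + 1) ^ (-ν.re - 1 / 2) := by
  have h : ‖((ξ : ℂ) - Complex.I) / ((ξ : ℂ) + Complex.I)‖ = 1 := by
    have : (ξ : ℂ) - Complex.I = (starRingEnd ℂ) ((ξ : ℂ) + Complex.I) := by
      simp [sub_eq_add_neg]
    rw [norm_div, this, Complex.norm_conj, div_self]
    simpa using ofReal_add_I_ne_zero ξ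
  rw [weightFun, norm_mul, norm_zpow, h, one_zpow, mul_one,
    Complex.norm_cpow_eq_rpow_re_of_pos (by positivity)]
  simp

lemma weightFun_neg (ℓ : ℤ) (ν : ℂ) (ξ : ℝ) : weightFun ℓ ν (-ξ) = weightFun (-ℓ) ν ξ := by
  have h : (((-ξ : ℝ) : ℂ) - Complex.I) / (((-ξ : ℝ) : ℂ) + Complex.I) =
      (((ξ : ℂ) - Complex.I) / ((ξ : ℂ) + Complex.I))⁻¹ := by
    rw [inv_div, ← neg_div_neg_eq]
    congr 1 <;> · push_cast; ring
  rw [weightFun, weightFun, h, neg_sq, inv_zpow, zpow_neg]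

lemma weightFun_inv (ℓ : ℤ) (ν : ℂ) {ξ : ℝ} (hξ : 0 < ξ) :
    weightFun ℓ ν ξ⁻¹ = (-1) ^ ℓ * ((ξ : ℂ) ^ (2 * ν + 1) * weightFun (-ℓ) ν ξ) := by
  have hξ' : (ξ : ℂ) ≠ 0 := by exact_mod_cast hξ.ne'
  have h : (((ξ⁻¹ : ℝ) : ℂ) - Complex.I) / (((ξ⁻¹ : ℝ) : ℂ) + Complex.I) =
      (-1) * (((ξ : ℂ) - Complex.I) / ((ξ : ℂ) + Complex.I))⁻¹ := by
    have e1 : (((ξ⁻¹ : ℝ) : ℂ) - Complex.I) = (-Complex.I * (ξ : ℂ)⁻¹) * (ξ + Complex.I) := by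
      push_cast
      field_simp
      linear_combination Complex.I_sq
    have e2 : (((ξ⁻¹ : ℝ) : ℂ) + Complex.I) = (-Complex.I * (ξ : ℂ)⁻¹) * -(ξ - Complex.I) := by
      push_cast
      field_simp
      linear_combination Complex.I_sq
    rw [e1, e2, mul_div_mul_left _ _ (by simp [hξ']), inv_div, div_neg]
    ring
  have hb : (((ξ⁻¹ : ℝ) ^ 2 + 1 : ℝ) : ℂ) ^ (-ν - 1 / 2) =
      (ξ : ℂ) ^ (2 * ν + 1) * ((ξ ^ 2 + 1 : ℝ) : ℂ) ^ (-ν - 1 / 2) := by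
    have hp : 0 < ξ ^ 2 + 1 := by positivity
    have : (ξ⁻¹ : ℝ) ^ 2 + 1 = (ξ ^ 2)⁻¹ * (ξ ^ 2 + 1) := by
      field_simp
      ring
    have hne : (((ξ ^ 2)⁻¹ * (ξ ^ 2 + 1) : ℝ) : ℂ) ≠ 0 :=
      Complex.ofReal_ne_zero.2 (by positivity)
    have hne' : ((ξ ^ 2 + 1 : ℝ) : ℂ) ≠ 0 := Complex.ofReal_ne_zero.2 hp.ne'
    rw [this, Complex.cpow_def_of_ne_zero hne, Complex.cpow_def_of_ne_zero hne',
      Complex.cpow_def_of_ne_zero hξ',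
      ← Complex.ofReal_log (by positivity), ← Complex.ofReal_log hp.le,
      ← Complex.ofReal_log hξ.le, Real.log_mul (by positivity) hp.ne', Real.log_inv, Real.log_pow,
      ← Complex.exp_add]
    congr 1
    push_cast
    ring
  rw [weightFun, weightFun, h, hb, mul_zpow, inv_zpow, zpow_neg]
  ring

lemma hasDerivAt_weightFun (ℓ : ℤ) (ν : ℂ) (ξ : ℝ) :
    HasDerivAt (weightFun ℓ ν)
      ((((-ν - 1 / 2) * (2 * ξ) + 2 * Complex.I * ℓ) / ((ξ ^ 2 + 1 : ℝ) : ℂ)) *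
        weightFun ℓ ν ξ) ξ := by
  have h1 := ofReal_add_I_ne_zero ξ
  have h2 := ofReal_sub_I_ne_zero ξ
  have hp : 0 < ξ ^ 2 + 1 := by positivity
  have hp' : ((ξ ^ 2 + 1 : ℝ) : ℂ) ≠ 0 := by exact_mod_cast hp.ne'
  have hfac : ((ξ ^ 2 + 1 : ℝ) : ℂ) = (ξ + Complex.I) * (ξ - Complex.I) := by
    push_cast; linear_combination Complex.I_sq
  have hbase : HasDerivAt (fun z : ℂ => z ^ 2 + 1) (2 * (ξ : ℂ)) (ξ : ℂ) := by
    simpa using (hasDerivAt_pow 2 (ξ : ℂ)).add_const 1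
  have hA := hbase.cpow_const (c := -ν - 1 / 2) (by
    have : ((ξ : ℂ) ^ 2 + 1) = ((ξ ^ 2 + 1 : ℝ) : ℂ) := by push_cast; rfl
    rw [this]
    exact Complex.ofReal_mem_slitPlane.2 hp)
  have hq : HasDerivAt (fun z : ℂ => (z - Complex.I) / (z + Complex.I)) _ (ξ : ℂ) :=
    ((hasDerivAt_id (ξ : ℂ)).sub_const Complex.I).div
      ((hasDerivAt_id (ξ : ℂ)).add_const Complex.I) h1
  have hB := (hasDerivAt_zpow ℓ _ (Or.inl (ofReal_sub_I_div_add_I_ne_zero ξ))).comp (ξ : ℂ) hq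
  have h := (hA.mul hB).comp_ofReal
  have hfun : weightFun ℓ ν = fun x : ℝ => ((x : ℂ) ^ 2 + 1) ^ (-ν - 1 / 2) *
      (((x : ℂ) - Complex.I) / ((x : ℂ) + Complex.I)) ^ ℓ := by
    ext x
    simp [weightFun]
  have hval : ((ξ : ℂ) ^ 2 + 1) = ((ξ ^ 2 + 1 : ℝ) : ℂ) := by push_cast; rfl
  refine (h.congr_of_eventuallyEq (EventuallyEq.of_eq hfun)).congr_deriv ?_
  simp only [Function.comp_apply, id, weightFun]
  rw [hval, Complex.cpow_sub _ _ hp', Complex.cpow_one,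
    zpow_sub_one₀ (ofReal_sub_I_div_add_I_ne_zero ξ), inv_div]
  generalize ((ξ ^ 2 + 1 : ℝ) : ℂ) ^ (-ν - 1 / 2) = X
  generalize (((ξ : ℂ) - Complex.I) / ((ξ : ℂ) + Complex.I)) ^ ℓ = Y
  rw [hfac]
  field_simp
  ring

lemma continuous_weightFun (ℓ : ℤ) (ν : ℂ) : Continuous (weightFun ℓ ν) :=
  continuous_iff_continuousAt.2 fun ξ => (hasDerivAt_weightFun ℓ ν ξ).continuousAt

lemma integrable_weightFun (ℓ : ℤ) {ν : ℂ} (hν : 0 < ν.re) : Integrable (weightFun ℓ ν) := by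
  have h := integrable_rpow_neg_one_add_norm_sq (E := ℝ) (μ := volume) (r := 2 * ν.re + 1)
    (by simpa using hν)
  refine h.mono' (continuous_weightFun ℓ ν).aestronglyMeasurable (Eventually.of_forall fun ξ => ?_)
  rw [norm_weightFun]
  refine le_of_eq ?_
  rw [Real.norm_eq_abs, sq_abs, add_comm]
  congr 1
  ring

lemma integrable_deriv_weightFun (ℓ : ℤ) {ν : ℂ} (hν : 0 < ν.re) :
    Integrable (deriv (weightFun ℓ ν)) := by
  have hd : deriv (weightFun ℓ ν) = fun ξ : ℝ =>
      (((-ν - 1 / 2) * (2 * ξ) + 2 * Complex.I * ℓ) / ((ξ ^ 2 + 1 : ℝ) : ℂ)) *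
        weightFun ℓ ν ξ := funext fun ξ => (hasDerivAt_weightFun ℓ ν ξ).deriv
  rw [hd]
  refine (integrable_weightFun ℓ hν).bdd_mul (c := ‖-ν - 1 / 2‖ + 2 * ‖(ℓ : ℂ)‖)
    (Measurable.aestronglyMeasurable (by fun_prop)) (Eventually.of_forall fun ξ => ?_)
  have hp : 0 < ξ ^ 2 + 1 := by positivity
  rw [norm_div, Complex.norm_of_nonneg hp.le, div_le_iff₀ hp]
  have h1 : 2 * |ξ| ≤ ξ ^ 2 + 1 := by
    rw [← sq_abs]; nlinarith [sq_nonneg (|ξ| - 1)]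
  have h2 : 1 ≤ ξ ^ 2 + 1 := by nlinarith [sq_nonneg ξ]
  calc _ ≤ ‖(-ν - 1 / 2) * (2 * ξ)‖ + ‖2 * Complex.I * (ℓ : ℂ)‖ := norm_add_le _ _
    _ = ‖-ν - 1 / 2‖ * (2 * |ξ|) + 2 * ‖(ℓ : ℂ)‖ * 1 := by
      simp only [norm_mul, Complex.norm_I, Complex.norm_real, Real.norm_eq_abs]
      simp
    _ ≤ ‖-ν - 1 / 2‖ * (ξ ^ 2 + 1) + 2 * ‖(ℓ : ℂ)‖ * (ξ ^ 2 + 1) := by gcongr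
    _ = _ := by ring

lemma mellinConvergent_weightFun (ℓ : ℤ) {ν a : ℂ} (hν : 0 < ν.re) (ha0 : 0 < a.re)
    (ha1 : a.re < 1) : MellinConvergent (weightFun ℓ ν) (1 - a) := by
  refine mellinConvergent_of_isBigO_rpow (a := 2 * ν.re + 1) (b := 0)
    ((continuous_weightFun ℓ ν).locallyIntegrable.locallyIntegrableOn _) ?_ ?_ ?_ ?_
  · refine Asymptotics.IsBigO.of_bound 1 ?_
    filter_upwards [eventually_gt_atTop 0] with ξ hξ
    rw [norm_weightFun, one_mul, Real.norm_of_nonneg (by positivity),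
      show -(2 * ν.re + 1) = 2 * (-ν.re - 1 / 2) by ring, Real.rpow_mul hξ.le]
    refine Real.rpow_le_rpow_of_nonpos (by positivity) ?_ (by linarith)
    norm_num
  · simp; linarith
  · refine Asymptotics.IsBigO.of_bound 1 (Eventually.of_forall fun ξ => ?_)
    rw [norm_weightFun]
    simp only [neg_zero, Real.rpow_zero, norm_one, mul_one]
    exact Real.rpow_le_one_of_one_le_of_nonpos (by nlinarith [sq_nonneg ξ]) (by linarith)
  · simpa using ha1

lemma mellinConvergent_fourier {f : ℝ → ℂ} (hf : Integrable f) (hd : Differentiable ℝ f)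
    (hf' : Integrable (deriv f)) {a : ℂ} (ha0 : 0 < a.re) (ha1 : a.re < 1) :
    MellinConvergent (𝓕 f) a := by
  have hc : Continuous (𝓕 f) := VectorFourier.fourierIntegral_continuous
    Real.continuous_fourierChar (by exact continuous_inner) hf
  have hbound : ∀ (g : ℝ → ℂ) (y : ℝ), ‖𝓕 g y‖ ≤ ∫ ξ, ‖g ξ‖ := fun g y =>
    VectorFourier.norm_fourierIntegral_le_integral_norm _ _ _ _ _
  refine mellinConvergent_of_isBigO_rpow (a := 1) (b := 0)
    (hc.locallyIntegrable.locallyIntegrableOn _) ?_ ha1 ?_ ha0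
  · refine Asymptotics.IsBigO.of_bound (∫ ξ, ‖deriv f ξ‖) ?_
    filter_upwards [eventually_gt_atTop 0] with y hy
    have h := hbound (deriv f) y
    rw [Real.fourier_deriv hf hd hf', norm_smul] at h
    have hn : ‖(2 * Real.pi * Complex.I * y : ℂ)‖ = 2 * Real.pi * y := by
      simp [abs_of_pos Real.pi_pos, abs_of_pos hy]
    rw [hn] at h
    rw [Real.rpow_neg_one, Real.norm_of_nonneg (by positivity), ← div_eq_mul_inv, le_div_iff₀ hy]
    refine le_trans ?_ h
    have : 1 ≤ 2 * Real.pi := by linarith [Real.pi_gt_three]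
    calc ‖𝓕 f y‖ * y = 1 * y * ‖𝓕 f y‖ := by ring
      _ ≤ _ := by gcongr
  · refine Asymptotics.IsBigO.of_bound (∫ ξ, ‖f ξ‖) (Eventually.of_forall fun y => ?_)
    simpa using hbound f y

lemma mellinConvergent_fourier_weightFun (ℓ : ℤ) {ν a : ℂ} (hν : 0 < ν.re) (ha0 : 0 < a.re)
    (ha1 : a.re < 1) : MellinConvergent (𝓕 (weightFun ℓ ν)) a :=
  mellinConvergent_fourier (integrable_weightFun ℓ hν)
    (fun ξ => (hasDerivAt_weightFun ℓ ν ξ).differentiableAt) (integrable_deriv_weightFun ℓ hν)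
    ha0 ha1

lemma mellin_fourier_weightFun (ℓ : ℤ) {ν a : ℂ} (hν : 0 < ν.re) (ha0 : 0 < a.re)
    (ha1 : a.re < 1) :
    mellin (𝓕 (weightFun ℓ ν)) a = ((2 * Real.pi : ℝ) : ℂ) ^ (-a) * Complex.Gamma a *
      (Complex.exp (-(Real.pi * Complex.I * a / 2)) * mellin (weightFun ℓ ν) (1 - a) +
        Complex.exp (Real.pi * Complex.I * a / 2) * mellin (weightFun (-ℓ) ν) (1 - a)) := by
  have hneg : (fun ξ => weightFun ℓ ν (-ξ)) = weightFun (-ℓ) ν := funext (weightFun_neg ℓ ν)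
  rw [mellin_fourier_eq (integrable_weightFun ℓ hν) ha0
    (mellinConvergent_fourier_weightFun ℓ hν ha0 ha1) (mellinConvergent_weightFun ℓ hν ha0 ha1)
    (by rw [hneg]; exact mellinConvergent_weightFun (-ℓ) hν ha0 ha1), hneg]

/-- The functional equation of the Mellin transform of `weightFun` under `ξ ↦ ξ⁻¹`. -/
lemma mellin_weightFun (ℓ : ℤ) (ν z : ℂ) :
    mellin (weightFun ℓ ν) z = (-1) ^ ℓ * mellin (weightFun (-ℓ) ν) (2 * ν + 1 - z) := by
  have h := mellin_comp_inv (weightFun ℓ ν) (-z)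
  rw [neg_neg] at h
  rw [← h, show 2 * ν + 1 - z = -z + (2 * ν + 1) by ring, ← mellin_cpow_smul, ← smul_eq_mul,
    ← mellin_const_smul]
  refine setIntegral_congr_fun measurableSet_Ioi fun ξ hξ => ?_
  simp only [weightFun_inv ℓ ν hξ, smul_eq_mul]

/-- The coefficient identities behind the local functional equation. -/
lemma cos_mul_exp_add_cos_mul_exp (s ν : ℂ) :
    Complex.cos (Real.pi * s) * Complex.exp (-(Real.pi * Complex.I * (1 - s - ν) / 2)) +
      Complex.cos (Real.pi * ν) * Complex.exp (Real.pi * Complex.I * (1 - s - ν) / 2) =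
        Complex.sin (Real.pi * (s + ν)) * Complex.exp (Real.pi * Complex.I * (s - ν) / 2) ∧
    Complex.cos (Real.pi * s) * Complex.exp (Real.pi * Complex.I * (1 - s - ν) / 2) +
      Complex.cos (Real.pi * ν) * Complex.exp (-(Real.pi * Complex.I * (1 - s - ν) / 2)) =
        Complex.sin (Real.pi * (s + ν)) * Complex.exp (-(Real.pi * Complex.I * (s - ν) / 2)) := by
  set u := Complex.exp (Real.pi * Complex.I * s / 2) with hu
  set v := Complex.exp (Real.pi * Complex.I * ν / 2) with hv
  have hu0 : u ≠ 0 := Complex.exp_ne_zero _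
  have hv0 : v ≠ 0 := Complex.exp_ne_zero _
  have e1 : Complex.exp (Real.pi * Complex.I * (1 - s - ν) / 2) =
      Complex.I * (u⁻¹ * v⁻¹) := by
    conv_rhs => rw [← Complex.exp_pi_div_two_mul_I]
    rw [hu, hv, ← Complex.exp_neg, ← Complex.exp_neg, ← Complex.exp_add, ← Complex.exp_add]
    congr 1
    ring
  have e2 : Complex.exp (-(Real.pi * Complex.I * (1 - s - ν) / 2)) = -Complex.I * (u * v) := by
    rw [Complex.exp_neg, e1, mul_inv, mul_inv, inv_inv, inv_inv, Complex.inv_I]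
  have e3 : Complex.exp (Real.pi * Complex.I * (s - ν) / 2) = u * v⁻¹ := by
    rw [hu, hv, ← Complex.exp_neg, ← Complex.exp_add]
    congr 1
    ring
  have e4 : Complex.exp (-(Real.pi * Complex.I * (s - ν) / 2)) = u⁻¹ * v := by
    rw [Complex.exp_neg, e3, mul_inv, inv_inv]
  have hsq : ∀ z : ℂ, Complex.exp (Real.pi * z * Complex.I) =
      Complex.exp (Real.pi * Complex.I * z / 2) ^ 2 := fun z => by
    rw [← Complex.exp_nat_mul]
    congr 1
    push_cast
    ring
  have e5 : Complex.cos (Real.pi * s) = (u ^ 2 + (u ^ 2)⁻¹) / 2 := by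
    rw [Complex.cos, neg_mul, Complex.exp_neg, hsq]
  have e6 : Complex.cos (Real.pi * ν) = (v ^ 2 + (v ^ 2)⁻¹) / 2 := by
    rw [Complex.cos, neg_mul, Complex.exp_neg, hsq]
  have e7 : Complex.sin (Real.pi * (s + ν)) =
      ((u ^ 2 * v ^ 2)⁻¹ - u ^ 2 * v ^ 2) * Complex.I / 2 := by
    rw [Complex.sin, neg_mul, Complex.exp_neg, mul_add, add_mul, Complex.exp_add, hsq, hsq]
  rw [e1, e2, e3, e4, e5, e6, e7]
  constructor <;> · field_simp; ring

lemma exp_mul_cpow_mul_zpow_eq (ℓ : ℤ) (ν : ℂ) (y ξ : ℝ) :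
    Complex.exp (-2 * (Real.pi : ℂ) * Complex.I * (y : ℂ) * (ξ : ℂ)) *
      ((ξ ^ 2 + 1 : ℝ) : ℂ) ^ (-ν - 1 / 2) *
      (((ξ : ℂ) - Complex.I) / ((ξ : ℂ) + Complex.I)) ^ ℓ =
    Complex.exp (↑(-2 * Real.pi * ξ * y) * Complex.I) • weightFun ℓ ν ξ := by
  rw [weightFun, smul_eq_mul, mul_assoc]
  congr 2
  push_cast
  ring

lemma integral_exp_mul_cpow_mul_zpow_eq (ℓ : ℤ) (ν : ℂ) (y : ℝ) :
    ∫ ξ : ℝ, Complex.exp (-2 * (Real.pi : ℂ) * Complex.I * (y : ℂ) * (ξ : ℂ)) *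
      ((ξ ^ 2 + 1 : ℝ) : ℂ) ^ (-ν - 1 / 2) *
      (((ξ : ℂ) - Complex.I) / ((ξ : ℂ) + Complex.I)) ^ ℓ = 𝓕 (weightFun ℓ ν) y := by
  rw [Real.fourier_real_eq_integral_exp_smul]
  simp_rw [exp_mul_cpow_mul_zpow_eq]

lemma GammaEll_eq_mellin (ℓ : ℤ) (s ν : ℂ) :
    GammaEll ℓ s ν = mellin (𝓕 (weightFun ℓ ν)) (s - ν) := by
  simp_rw [GammaEll, mellin, integral_exp_mul_cpow_mul_zpow_eq, smul_eq_mul]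

/-- Local functional equation of Jacquet–Langlands type. -/
theorem jacquet_langlands_local_functional_equation (ℓ : ℤ) (ν s : ℂ)
    (hν0 : 0 < ν.re) (hν1 : ν.re < 1 / 2) (hs0 : ν.re < s.re) (hs1 : s.re < 1 - ν.re) :
    (∀ y : ℝ, 0 < y →
      Integrable (fun ξ : ℝ =>
        Complex.exp (-2 * (Real.pi : ℂ) * Complex.I * (y : ℂ) * (ξ : ℂ)) *
          ((ξ ^ 2 + 1 : ℝ) : ℂ) ^ (-ν - 1 / 2) *
          (((ξ : ℂ) - Complex.I) / ((ξ : ℂ) + Complex.I)) ^ ℓ)) ∧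
    IntegrableOn (fun y : ℝ =>
      (y : ℂ) ^ (s - ν - 1) *
        ∫ ξ : ℝ,
          Complex.exp (-2 * (Real.pi : ℂ) * Complex.I * (y : ℂ) * (ξ : ℂ)) *
            ((ξ ^ 2 + 1 : ℝ) : ℂ) ^ (-ν - 1 / 2) *
            (((ξ : ℂ) - Complex.I) / ((ξ : ℂ) + Complex.I)) ^ ℓ) (Set.Ioi 0) ∧
    (-1 : ℂ) ^ ℓ * GammaEll ℓ s ν =
      2 * ((2 * Real.pi : ℝ) : ℂ) ^ (-2 * s) * Complex.Gamma (s + ν) * Complex.Gamma (s - ν) *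
        (Complex.cos ((Real.pi : ℂ) * s) * GammaEll ℓ (1 - s) ν +
          Complex.cos ((Real.pi : ℂ) * ν) * GammaEll (-ℓ) (1 - s) ν) := by
  have ha0 : 0 < (s - ν).re := by simp; linarith
  have ha1 : (s - ν).re < 1 := by simp; linarith
  have hb0 : 0 < (1 - s - ν).re := by simp; linarith
  have hb1 : (1 - s - ν).re < 1 := by simp; linarith
  refine ⟨fun y _ => ?_, ?_, ?_⟩
  · simp_rw [exp_mul_cpow_mul_zpow_eq, smul_eq_mul]
    exact (integrable_weightFun ℓ hν0).bdd_mul (c := 1)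
      (Measurable.aestronglyMeasurable (by fun_prop))
      (Eventually.of_forall fun ξ => (Complex.norm_exp_ofReal_mul_I _).le)
  · simp_rw [integral_exp_mul_cpow_mul_zpow_eq]
    exact mellinConvergent_fourier_weightFun ℓ hν0 ha0 ha1
  · have hsin : Complex.sin (Real.pi * (s + ν)) ≠ 0 := fun h0 => by
      have h := Complex.Gamma_mul_Gamma_one_sub (s + ν)
      rw [h0, div_zero] at h
      refine mul_ne_zero (Complex.Gamma_ne_zero_of_re_pos ?_)
        (Complex.Gamma_ne_zero_of_re_pos ?_) h
      · simp; linarith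
      · simp; linarith
    have hrefl : Complex.Gamma (s + ν) * Complex.Gamma (1 - s - ν) *
        Complex.sin (Real.pi * (s + ν)) = Real.pi := by
      rw [sub_sub, Complex.Gamma_mul_Gamma_one_sub, div_mul_cancel₀ _ hsin]
    have hsign : ((-1 : ℂ) ^ ℓ) * (-1) ^ ℓ = 1 := by
      rw [← mul_zpow]; simp
    have hsign' : (-1 : ℂ) ^ (-ℓ) = (-1) ^ ℓ := by
      rw [zpow_neg, ← inv_zpow, inv_neg_one]
    have h2pi : ((2 * Real.pi : ℝ) : ℂ) ≠ 0 :=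
      Complex.ofReal_ne_zero.2 (by positivity)
    have hpow : ((2 * Real.pi : ℝ) : ℂ) ^ (-(s - ν)) =
        ((2 * Real.pi : ℝ) : ℂ) ^ (-2 * s) * ((2 * Real.pi : ℝ) : ℂ) ^ (-(1 - s - ν)) *
          (2 * (Complex.Gamma (s + ν) * Complex.Gamma (1 - s - ν) *
            Complex.sin (Real.pi * (s + ν)))) := by
      rw [hrefl, show -(s - ν) = -2 * s + -(1 - s - ν) + 1 by ring, Complex.cpow_add _ _ h2pi,
        Complex.cpow_add _ _ h2pi, Complex.cpow_one]
      push_cast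
      rfl
    obtain ⟨hc1, hc2⟩ := cos_mul_exp_add_cos_mul_exp s ν
    rw [GammaEll_eq_mellin, GammaEll_eq_mellin, GammaEll_eq_mellin,
      mellin_fourier_weightFun ℓ hν0 ha0 ha1, mellin_fourier_weightFun ℓ hν0 hb0 hb1,
      mellin_fourier_weightFun (-ℓ) hν0 hb0 hb1, neg_neg, mellin_weightFun ℓ ν (1 - (s - ν)),
      mellin_weightFun (-ℓ) ν (1 - (s - ν)), neg_neg, hsign',
      show 2 * ν + 1 - (1 - (s - ν)) = 1 - (1 - s - ν) by ring, hpow]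
    set A := mellin (weightFun ℓ ν) (1 - (1 - s - ν))
    set B := mellin (weightFun (-ℓ) ν) (1 - (1 - s - ν))
    set P := ((2 * Real.pi : ℝ) : ℂ) ^ (-2 * s)
    set Q := ((2 * Real.pi : ℝ) : ℂ) ^ (-(1 - s - ν))
    set G1 := Complex.Gamma (s + ν)
    set G2 := Complex.Gamma (s - ν)
    set G3 := Complex.Gamma (1 - s - ν)
    linear_combination
      (2 * P * Q * G1 * G2 * G3 * Complex.sin (Real.pi * (s + ν)) *
        (Complex.exp (-(Real.pi * Complex.I * (s - ν) / 2)) * B +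
          Complex.exp (Real.pi * Complex.I * (s - ν) / 2) * A)) * hsign -
      2 * P * Q * G1 * G2 * G3 * A * hc1 - 2 * P * Q * G1 * G2 * G3 * B * hc2
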